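/- Let G ≤ GL₂(ℂ) be finite, nonabelian, with defining representation ρ and image a dihedral group in PGL₂(ℂ), such that -I₂ ∈ G and ρ ≅ det(ρ) ⊗ ρ (equivalently ρ is self-dual). Then G is isomorphic to a dihedral group or a binary dihedral group. -/

import Mathlib

open Matrix

noncomputable section

/-- The projection `π : GL₂(ℂ) → PGL₂(ℂ)`, realised as the quotient map by the centre
(the scalar matrices). -/
def projPGL2 : Matrix.GeneralLinearGroup (Fin 2) ℂ →*
    Matrix.GeneralLinearGroup (Fin 2) ℂ ⧸ Subgroup.center (Matrix.GeneralLinearGroup (Fin 2) ℂ) :=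
  QuotientGroup.mk' (Subgroup.center (Matrix.GeneralLinearGroup (Fin 2) ℂ))

/-- The power `a ^ i` for an exponent `i` modulo the order of `a`. -/
def zmodPow {Γ : Type*} [Group Γ] (a : Γ) (i : ZMod (orderOf a)) : Γ :=
  a ^ (i.cast : ℤ)

theorem zmodPow_intCast {Γ : Type*} [Group Γ] (a : Γ) (z : ℤ) :
    zmodPow a (z : ZMod (orderOf a)) = a ^ z := by
  rw [zmodPow, ZMod.coe_intCast, zpow_mod_orderOf]

theorem zmodPow_injective {Γ : Type*} [Group Γ] (a : Γ) : Function.Injective (zmodPow a) := by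
  intro i j h
  obtain ⟨z, rfl⟩ := ZMod.intCast_surjective i
  obtain ⟨w, rfl⟩ := ZMod.intCast_surjective j
  rw [zmodPow_intCast, zmodPow_intCast, zpow_eq_zpow_iff_modEq] at h
  exact (ZMod.intCast_eq_intCast_iff _ _ _).mpr h

theorem zpow_mul_of_conj_eq_inv {Γ : Type*} [Group Γ] {a s : Γ} (hsa : s⁻¹ * a * s = a⁻¹)
    (z : ℤ) : a ^ z * s = s * a ^ (-z) := by
  have h : s⁻¹ * a ^ z * s = a ^ (-z) := by
    rw [_root_.zpow_neg, ← _root_.inv_zpow, ← hsa]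
    simpa using (conj_zpow (i := z) (a := s⁻¹) (b := a)).symm
  rw [← h]
  group

/-- A group with a cyclic subgroup `⟨a⟩` and an involution `s ∉ ⟨a⟩` inverting `a`, such that
`⟨a⟩` and `s⟨a⟩` cover the group, is dihedral. -/
theorem nonempty_mulEquiv_dihedralGroup {Γ : Type*} [Group Γ] (a s : Γ) (hs : s * s = 1)
    (hsa : s⁻¹ * a * s = a⁻¹) (hmem : ∀ z : ℤ, a ^ z ≠ s)
    (hcover : ∀ g : Γ, ∃ z : ℤ, g = a ^ z ∨ g = s * a ^ z) :
    Nonempty (Γ ≃* DihedralGroup (orderOf a)) := by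
  have hcomm := zpow_mul_of_conj_eq_inv hsa
  let f : DihedralGroup (orderOf a) → Γ
    | .r i => zmodPow a i
    | .sr i => s * zmodPow a i
  have hmul : ∀ x y, f (x * y) = f x * f y := by
    rintro (i | i) (j | j) <;> obtain ⟨z, rfl⟩ := ZMod.intCast_surjective i <;>
      obtain ⟨w, rfl⟩ := ZMod.intCast_surjective j <;>
      simp only [f, DihedralGroup.r_mul_r, DihedralGroup.r_mul_sr, DihedralGroup.sr_mul_r,
        DihedralGroup.sr_mul_sr, ← Int.cast_add, ← Int.cast_sub, zmodPow_intCast]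
    · rw [_root_.zpow_add]
    · rw [← mul_assoc, hcomm, mul_assoc, ← _root_.zpow_add, neg_add_eq_sub]
    · rw [_root_.zpow_add, mul_assoc]
    · rw [mul_assoc, ← mul_assoc (a ^ z), hcomm, mul_assoc, ← _root_.zpow_add, ← mul_assoc, hs,
        one_mul, neg_add_eq_sub]
  have hne : ∀ i j : ZMod (orderOf a), zmodPow a i ≠ s * zmodPow a j := by
    intro i j h
    refine hmem ((i.cast : ℤ) - (j.cast : ℤ)) ?_
    rw [_root_.zpow_sub]
    exact mul_inv_eq_of_eq_mul h
  refine ⟨(MulEquiv.ofBijective (MonoidHom.mk' f hmul) ⟨?_, fun g => ?_⟩).symm⟩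
  · rintro (i | i) (j | j) h
    · rw [zmodPow_injective a h]
    · exact (hne i j h).elim
    · exact (hne j i h.symm).elim
    · rw [zmodPow_injective a (mul_left_cancel h)]
  · obtain ⟨z, rfl | rfl⟩ := hcover g
    · exact ⟨.r z, zmodPow_intCast a z⟩
    · exact ⟨.sr z, congrArg (s * ·) (zmodPow_intCast a z)⟩

/-- A group with a cyclic subgroup `⟨a⟩` of order `2 * n` and an element `s ∉ ⟨a⟩` inverting `a`
with `s * s = a ^ n`, such that `⟨a⟩` and `s⟨a⟩` cover the group, is generalized quaternion. -/
theorem nonempty_mulEquiv_quaternionGroup {Γ : Type*} [Group Γ] {n : ℕ} (a s : Γ)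
    (ha : orderOf a = 2 * n) (hs : s * s = a ^ n)
    (hsa : s⁻¹ * a * s = a⁻¹) (hmem : ∀ z : ℤ, a ^ z ≠ s)
    (hcover : ∀ g : Γ, ∃ z : ℤ, g = a ^ z ∨ g = s * a ^ z) :
    Nonempty (Γ ≃* QuaternionGroup n) := by
  have hcomm := zpow_mul_of_conj_eq_inv hsa
  obtain ⟨p, hp, hinj⟩ : ∃ p : ZMod (2 * n) → Γ,
      (∀ z : ℤ, p z = a ^ z) ∧ Function.Injective p := by
    rw [← ha]
    exact ⟨zmodPow a, zmodPow_intCast a, zmodPow_injective a⟩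
  let f : QuaternionGroup n → Γ
    | .a i => p i
    | .xa i => s * p i
  have hmul : ∀ x y, f (x * y) = f x * f y := by
    rintro (i | i) (j | j) <;> obtain ⟨z, rfl⟩ := ZMod.intCast_surjective i <;>
      obtain ⟨w, rfl⟩ := ZMod.intCast_surjective j <;>
      simp only [f, QuaternionGroup.a_mul_a, QuaternionGroup.a_mul_xa, QuaternionGroup.xa_mul_a,
        QuaternionGroup.xa_mul_xa, ← Int.cast_add, ← Int.cast_sub, ← Int.cast_natCast (R := ZMod _),
        hp]
    · rw [_root_.zpow_add]
    · rw [← mul_assoc, hcomm, mul_assoc, ← _root_.zpow_add, neg_add_eq_sub]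
    · rw [_root_.zpow_add, mul_assoc]
    · rw [mul_assoc, ← mul_assoc (a ^ z), hcomm, mul_assoc, ← _root_.zpow_add, ← mul_assoc, hs,
        ← zpow_natCast, ← _root_.zpow_add, neg_add_eq_sub, add_sub_assoc]
  have hne : ∀ i j : ZMod (2 * n), p i ≠ s * p j := by
    intro i j h
    obtain ⟨z, rfl⟩ := ZMod.intCast_surjective i
    obtain ⟨w, rfl⟩ := ZMod.intCast_surjective j
    rw [hp, hp] at h
    refine hmem (z - w) ?_
    rw [_root_.zpow_sub]
    exact mul_inv_eq_of_eq_mul h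
  refine ⟨(MulEquiv.ofBijective (MonoidHom.mk' f hmul) ⟨?_, fun g => ?_⟩).symm⟩
  · rintro (i | i) (j | j) h
    · rw [hinj h]
    · exact (hne i j h).elim
    · exact (hne j i h.symm).elim
    · rw [hinj (mul_left_cancel h)]
  · obtain ⟨z, rfl | rfl⟩ := hcover g
    · exact ⟨.a z, hp z⟩
    · exact ⟨.xa z, congrArg (s * ·) (hp z)⟩

/-- A central extension of `DihedralGroup n` by `{1, c}` is generalized quaternion as soon as
its elements of order at most two all lie in the kernel. -/
theorem nonempty_mulEquiv_quaternionGroup_of_surjective {Γ : Type*} [Group Γ] {n : ℕ} (hn : n ≠ 0)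
    (q : Γ →* DihedralGroup n) (hq : Function.Surjective q) (c : Γ)
    (hc : c ≠ 1) (hcc : c * c = 1) (hcomm : ∀ g, c * g = g * c)
    (hker : ∀ g, q g = 1 ↔ g = 1 ∨ g = c) (hinv : ∀ g, g * g = 1 → q g = 1) :
    Nonempty (Γ ≃* QuaternionGroup n) := by
  have hqc : q c = 1 := (hker c).mpr (.inr rfl)
  have hsr : ∀ g i, q g = .sr i → g * g = c := by
    intro g i hg
    refine ((hker (g * g)).mp ?_).resolve_left fun h => ?_
    · rw [map_mul, hg, DihedralGroup.sr_mul_self]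
    · have h1 := hinv g h
      rw [hg, DihedralGroup.one_def] at h1
      cases h1
  obtain ⟨s, hs⟩ := hq (.sr 0)
  have hss := hsr s 0 hs
  obtain ⟨a, ha, han⟩ : ∃ a, q a = .r 1 ∧ a ^ n = c := by
    obtain ⟨a, ha⟩ := hq (.r 1)
    have hqn : q (a ^ n) = 1 := by rw [map_pow, ha, DihedralGroup.r_one_pow_n]
    rcases (hker _).mp hqn with h | h
    · rcases Nat.even_or_odd' n with ⟨m, hm | hm⟩
      · have h1 : q (a ^ m) = 1 := by
          refine hinv _ ?_
          rw [← pow_add, ← two_mul, ← hm, h]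
        rw [map_pow, ha] at h1
        have h2 := orderOf_dvd_of_pow_eq_one h1
        rw [DihedralGroup.orderOf_r_one] at h2
        have := Nat.le_of_dvd (by omega) h2
        omega
      · refine ⟨c * a, by rw [map_mul, hqc, one_mul, ha], ?_⟩
        rw [(show Commute c a from hcomm a).mul_pow, h, mul_one, hm, pow_succ, pow_mul, pow_two,
          hcc, one_pow, one_mul]
    · exact ⟨a, ha, h⟩
  have hqz : ∀ z : ℤ, q (a ^ z) = .r z := fun z => by
    rw [map_zpow, ha, DihedralGroup.r_one_zpow]
  have hsa : s * a * (s * a) = c := hsr (s * a) 1 (by rw [map_mul, hs, ha]; simp)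
  refine nonempty_mulEquiv_quaternionGroup a s ?_ (hss.trans han.symm) ?_ ?_ ?_
  · refine Nat.dvd_antisymm (orderOf_dvd_of_pow_eq_one ?_) ?_
    · rw [mul_comm, pow_mul, han, pow_two, hcc]
    · have h1 : n ∣ orderOf a := by
        rw [← DihedralGroup.orderOf_r_one (n := n), ← ha]
        exact orderOf_map_dvd q a
      obtain ⟨m, hm⟩ := h1
      have h2 : c ^ m = 1 := by rw [← han, ← pow_mul, ← hm, pow_orderOf_eq_one]
      have h3 : orderOf c = 2 := orderOf_eq_prime (by rw [pow_two, hcc]) hc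
      have h4 := orderOf_dvd_of_pow_eq_one h2
      rw [hm, mul_comm]
      exact Nat.mul_dvd_mul_left n (h3 ▸ h4)
  · have h1 : a * s * a = s := by
      rw [← hss] at hsa
      simpa [mul_assoc] using hsa
    rw [eq_inv_iff_mul_eq_one, mul_assoc, mul_assoc, ← mul_assoc a, h1, inv_mul_cancel]
  · intro z hz
    have h1 := hqz z
    rw [hz, hs] at h1
    cases h1
  · have hlift : ∀ g h, q g = q h → g = h ∨ g = h * c := by
      intro g h hgh
      have h1 : q (h⁻¹ * g) = 1 := by rw [map_mul, map_inv, hgh, inv_mul_cancel]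
      exact ((hker _).mp h1).imp (fun h => (inv_mul_eq_one.mp h).symm) inv_mul_eq_iff_eq_mul.mp
    intro g
    rcases hg : q g with i | i <;> obtain ⟨z, rfl⟩ := ZMod.intCast_surjective i
    · rcases hlift g (a ^ z) (by rw [hg, hqz]) with h | h
      · exact ⟨z, .inl h⟩
      · exact ⟨z + n, .inl (by rw [h, _root_.zpow_add, zpow_natCast, han])⟩
    · rcases hlift g (s * a ^ z) (by rw [hg, map_mul, hqz, hs]; simp) with h | h
      · exact ⟨z, .inr h⟩
      · exact ⟨z + n, .inr (by rw [h, _root_.zpow_add, zpow_natCast, han, mul_assoc])⟩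

theorem Matrix.mul_self_fin_two (A : Matrix (Fin 2) (Fin 2) ℂ) :
    A * A = A.trace • A - A.det • (1 : Matrix (Fin 2) (Fin 2) ℂ) := by
  ext i j
  fin_cases i <;> fin_cases j <;>
    simp [Matrix.mul_apply, Fin.sum_univ_two, Matrix.trace_fin_two, Matrix.det_fin_two] <;> ring

theorem Matrix.GeneralLinearGroup.mul_self_eq_one_of_conj_eq_neg
    {P s : Matrix.GeneralLinearGroup (Fin 2) ℂ} (hP : P * s * P⁻¹ = -s)
    (hdet : (s : Matrix (Fin 2) (Fin 2) ℂ).det = -1) : s * s = 1 := by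
  have htr : (s : Matrix (Fin 2) (Fin 2) ℂ).trace = 0 := by
    have h := congrArg (fun g : Matrix.GeneralLinearGroup (Fin 2) ℂ =>
      (g : Matrix (Fin 2) (Fin 2) ℂ).trace) hP
    simp only [Units.val_mul, Units.val_neg, Matrix.trace_neg, Matrix.trace_units_conj] at h
    exact self_eq_neg.mp h
  refine Units.ext ?_
  rw [Units.val_mul, Matrix.mul_self_fin_two, htr, hdet]
  simp

/-- A special linear `2 × 2` matrix which is its own inverse is central. -/
theorem Matrix.GeneralLinearGroup.mem_center_of_mul_self_eq_one
    {g : Matrix.GeneralLinearGroup (Fin 2) ℂ} (hdet : (g : Matrix (Fin 2) (Fin 2) ℂ).det = 1)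
    (hg : g * g = 1) : g ∈ Subgroup.center (Matrix.GeneralLinearGroup (Fin 2) ℂ) := by
  rw [mem_center_iff_val_mem_range_scalar]
  have h := Matrix.mul_self_fin_two (g : Matrix (Fin 2) (Fin 2) ℂ)
  rw [← Units.val_mul, hg, hdet, Units.val_one, one_smul, eq_sub_iff_add_eq] at h
  set t := (g : Matrix (Fin 2) (Fin 2) ℂ).trace
  have ht : t ≠ 0 := by
    intro ht
    have h00 := congrFun (congrFun h 0) 0
    rw [ht, zero_smul] at h00
    norm_num at h00
  refine ⟨t⁻¹ + t⁻¹, ?_⟩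
  have h1 : t⁻¹ • (t • (g : Matrix (Fin 2) (Fin 2) ℂ)) = t⁻¹ • (1 + 1) := by rw [h]
  rw [smul_smul, inv_mul_cancel₀ ht, one_smul] at h1
  rw [h1, map_add, smul_add, Matrix.smul_one_eq_diagonal, Matrix.scalar_apply]

theorem Matrix.GeneralLinearGroup.eq_one_or_neg_one_of_mem_center
    {g : Matrix.GeneralLinearGroup (Fin 2) ℂ} (hdet : (g : Matrix (Fin 2) (Fin 2) ℂ).det = 1)
    (hg : g ∈ Subgroup.center (Matrix.GeneralLinearGroup (Fin 2) ℂ)) : g = 1 ∨ g = -1 := by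
  obtain ⟨c, hc⟩ := mem_center_iff_val_mem_range_scalar.mp hg
  rw [← hc] at hdet
  have h : c ^ 2 = 1 := by simpa using hdet
  rcases eq_or_eq_neg_of_sq_eq_sq c 1 (by rw [h, one_pow]) with rfl | rfl
  · exact .inl (Units.ext (by rw [← hc]; simp))
  · exact .inr (Units.ext (by rw [← hc, map_neg, map_one, Units.val_neg, Units.val_one]))

/-- If `P` anticommutes with `s` and commutes with a finite linear group which `s` inverts, then
the group acts faithfully on an eigenline of `P`, hence is cyclic. -/
theorem Matrix.GeneralLinearGroup.isCyclic_of_commute_of_conj_eq_inv {Γ : Type*} [Group Γ]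
    [Finite Γ] (φ : Γ →* Matrix.GeneralLinearGroup (Fin 2) ℂ) (hφ : Function.Injective φ)
    (P s : Matrix.GeneralLinearGroup (Fin 2) ℂ) (hPs : P * s = -(s * P))
    (hcomm : ∀ h, P * φ h = φ h * P) (hinv : ∀ h, φ h * s = s * φ h⁻¹) : IsCyclic Γ := by
  obtain ⟨e, he⟩ := Module.End.exists_eigenvalue (Matrix.toLin' (P : Matrix (Fin 2) (Fin 2) ℂ))
  obtain ⟨v, hv⟩ := he.exists_hasEigenvector
  have hv0 : v ≠ 0 := hv.2
  have hPv : P.val *ᵥ v = e • v := by simpa using hv.apply_eq_smul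
  have hinjm : ∀ (g : Matrix.GeneralLinearGroup (Fin 2) ℂ) x, g.val *ᵥ x = 0 → x = 0 := by
    intro g x hx
    have h := congrArg (g⁻¹.val *ᵥ ·) hx
    simp only [Matrix.mulVec_mulVec, ← Units.val_mul, inv_mul_cancel, Units.val_one,
      Matrix.one_mulVec, Matrix.mulVec_zero] at h
    exact h
  have he0 : e ≠ 0 := by
    rintro rfl
    exact hv0 (hinjm P v (by rw [hPv, zero_smul]))
  set w := s.val *ᵥ v with hw
  have hw0 : w ≠ 0 := fun h => hv0 (hinjm s v h)
  have hPw : P.val *ᵥ w = -(e • w) := by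
    rw [hw, Matrix.mulVec_mulVec, ← Units.val_mul, hPs, Units.val_neg, Units.val_mul,
      Matrix.neg_mulVec, ← Matrix.mulVec_mulVec, hPv, Matrix.mulVec_smul]
  have hcancel : ∀ {b : ℂ} {x : Fin 2 → ℂ}, x ≠ 0 → (2 * e * b) • x = 0 → b = 0 := by
    intro b x hx h
    simpa [he0, hx] using h
  have hind : LinearIndependent ℂ ![v, w] := by
    rw [LinearIndependent.pair_iff]
    intro a b hab
    have h := congrArg (P.val *ᵥ ·) hab
    simp only [Matrix.mulVec_add, Matrix.mulVec_smul, hPv, hPw, Matrix.mulVec_zero] at h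
    constructor
    · refine hcancel hv0 ?_
      linear_combination (norm := module) e • hab + h
    · refine hcancel hw0 ?_
      linear_combination (norm := module) e • hab - h
  have hspan : ∀ x : Fin 2 → ℂ, ∃ a b : ℂ, a • v + b • w = x := by
    intro x
    have h := hind.span_eq_top_of_card_eq_finrank' (by simp)
    rw [Matrix.range_cons, Matrix.range_cons, Matrix.range_empty, Set.union_empty,
      Set.singleton_union] at h
    rw [← Submodule.mem_span_pair, h]
    trivial
  have heig : ∀ h, ∃ a : ℂ, (φ h).val *ᵥ v = a • v := by
    intro h
    obtain ⟨a, b, hab⟩ := hspan ((φ h).val *ᵥ v)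
    have h1 : P.val *ᵥ ((φ h).val *ᵥ v) = e • ((φ h).val *ᵥ v) := by
      rw [Matrix.mulVec_mulVec, ← Units.val_mul, hcomm, Units.val_mul, ← Matrix.mulVec_mulVec, hPv,
        Matrix.mulVec_smul]
    rw [← hab] at h1
    simp only [Matrix.mulVec_add, Matrix.mulVec_smul, hPv, hPw] at h1
    have hb : b = 0 := by
      refine hcancel hw0 ?_
      linear_combination (norm := module) -h1
    exact ⟨a, by rw [← hab, hb, zero_smul, add_zero]⟩
  choose χ hχ using heig
  have huniq : ∀ {a b : ℂ}, a • v = b • v → a = b := fun h => smul_left_injective ℂ hv0 h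
  let f : Γ →* ℂ :=
    { toFun := χ
      map_one' := huniq (by rw [← hχ]; simp)
      map_mul' := fun g h => huniq (by
        rw [← hχ, map_mul, Units.val_mul, ← Matrix.mulVec_mulVec, hχ, Matrix.mulVec_smul, hχ,
          smul_smul, mul_comm]) }
  refine isCyclic_of_injective_ringHom f ((injective_iff_map_eq_one f).mpr fun h hh => hφ ?_)
  have hinvχ : χ h⁻¹ = 1 := by
    have h1 : f (h⁻¹ * h) = 1 := by rw [inv_mul_cancel, map_one]
    rwa [map_mul, hh, mul_one] at h1
  have hhv : (φ h).val *ᵥ v = v := by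
    rw [hχ, show χ h = 1 from hh, one_smul]
  have hhw : (φ h).val *ᵥ w = w := by
    rw [hw, Matrix.mulVec_mulVec, ← Units.val_mul, hinv, Units.val_mul, ← Matrix.mulVec_mulVec, hχ,
      hinvχ, one_smul]
  rw [map_one]
  refine Units.ext (Matrix.ext_of_mulVec_single fun i => ?_)
  obtain ⟨a, b, hab⟩ := hspan (Pi.single i 1)
  rw [← hab, Matrix.mulVec_add, Matrix.mulVec_smul, Matrix.mulVec_smul, hhv, hhw]
  simp

theorem nonempty_mulEquiv_quaternionGroup_of_det_eq_one
    (G : Subgroup (Matrix.GeneralLinearGroup (Fin 2) ℂ)) {n : ℕ} (hn : n ≠ 0)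
    (himage : Nonempty (↥(Subgroup.map projPGL2 G) ≃* DihedralGroup n))
    (hneg : (-1 : Matrix.GeneralLinearGroup (Fin 2) ℂ) ∈ G)
    (hSL : ∀ g ∈ G, (g : Matrix (Fin 2) (Fin 2) ℂ).det = 1) :
    Nonempty (↥G ≃* QuaternionGroup n) := by
  obtain ⟨e⟩ := himage
  let q : ↥G →* DihedralGroup n := e.toMonoidHom.comp (projPGL2.subgroupMap G)
  have hq1 : ∀ g : ↥G, q g = 1 ↔
      (g : Matrix.GeneralLinearGroup (Fin 2) ℂ) ∈ Subgroup.center _ := by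
    intro g
    rw [← QuotientGroup.eq_one_iff]
    change e (projPGL2.subgroupMap G g) = 1 ↔ projPGL2 g.1 = 1
    rw [map_eq_one_iff e e.injective, ← Subtype.coe_inj]
    rfl
  refine nonempty_mulEquiv_quaternionGroup_of_surjective hn q
    (e.surjective.comp (projPGL2.subgroupMap_surjective G)) ⟨-1, hneg⟩ ?_ ?_ ?_ ?_ ?_
  · intro h
    have h00 := congrArg (fun g : ↥G => (g.1 : Matrix (Fin 2) (Fin 2) ℂ) 0 0) h
    norm_num at h00
  · exact Subtype.ext (by simp)
  · exact fun g => Subtype.ext (by simp)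
  · intro g
    rw [hq1]
    constructor
    · exact fun h => (Matrix.GeneralLinearGroup.eq_one_or_neg_one_of_mem_center
        (hSL g.1 g.2) h).imp Subtype.ext Subtype.ext
    · rintro (rfl | rfl)
      · exact one_mem _
      · exact Subgroup.mem_center_iff.mpr fun g => by simp
  · exact fun g hg => (hq1 g).mpr (Matrix.GeneralLinearGroup.mem_center_of_mul_self_eq_one
      (hSL g.1 g.2) (congrArg Subtype.val hg))

theorem exists_mulEquiv_dihedralGroup_of_det_eq_neg_one
    (G : Subgroup (Matrix.GeneralLinearGroup (Fin 2) ℂ)) [Finite G]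
    (P : Matrix.GeneralLinearGroup (Fin 2) ℂ)
    (hpos : ∀ g ∈ G, (g : Matrix (Fin 2) (Fin 2) ℂ).det = 1 → P * g * P⁻¹ = g)
    (hanti : ∀ g ∈ G, (g : Matrix (Fin 2) (Fin 2) ℂ).det = -1 → P * g * P⁻¹ = -g)
    (hdet : ∀ g ∈ G, (g : Matrix (Fin 2) (Fin 2) ℂ).det = 1 ∨
      (g : Matrix (Fin 2) (Fin 2) ℂ).det = -1)
    (s : Matrix.GeneralLinearGroup (Fin 2) ℂ) (hsG : s ∈ G)
    (hs : (s : Matrix (Fin 2) (Fin 2) ℂ).det = -1) :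
    ∃ k : ℕ, Nonempty (↥G ≃* DihedralGroup k) := by
  have hsq : ∀ g ∈ G, (g : Matrix (Fin 2) (Fin 2) ℂ).det = -1 → g * g = 1 := fun g hg h =>
    Matrix.GeneralLinearGroup.mul_self_eq_one_of_conj_eq_neg (hanti g hg h) h
  have hss := hsq s hsG hs
  let H : Subgroup ↥G := (Matrix.GeneralLinearGroup.det.comp G.subtype).ker
  have hH : ∀ g : ↥G, g ∈ H ↔ (g.1 : Matrix (Fin 2) (Fin 2) ℂ).det = 1 := fun g => by
    rw [MonoidHom.mem_ker, Units.ext_iff]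
    rfl
  have hinv : ∀ h ∈ H, h.1 * s = s * h.1⁻¹ := by
    intro h hh
    have h1 := hsq (s * h.1) (mul_mem hsG h.2)
      (by rw [Units.val_mul, Matrix.det_mul, hs, (hH h).mp hh, mul_one])
    have h2 : s⁻¹ = s := inv_eq_of_mul_eq_one_left hss
    rw [mul_assoc, mul_eq_one_iff_inv_eq, h2, ← mul_assoc] at h1
    exact eq_mul_inv_of_mul_eq h1.symm
  have hcyc : IsCyclic ↥H := by
    refine Matrix.GeneralLinearGroup.isCyclic_of_commute_of_conj_eq_inv (G.subtype.comp H.subtype)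
      (G.subtype_injective.comp H.subtype_injective) P s ?_ ?_ ?_
    · rw [mul_inv_eq_iff_eq_mul.mp (hanti s hsG hs), neg_mul]
    · exact fun h => mul_inv_eq_iff_eq_mul.mp (hpos h.1.1 h.1.2 ((hH h.1).mp h.2))
    · exact fun h => hinv h.1 h.2
  obtain ⟨a, ha⟩ := hcyc.exists_generator
  have hgen : ∀ g ∈ H, ∃ z : ℤ, a.1 ^ z = g := by
    intro g hg
    obtain ⟨z, hz⟩ := ha ⟨g, hg⟩
    exact ⟨z, congrArg Subtype.val hz⟩
  refine ⟨orderOf a.1, nonempty_mulEquiv_dihedralGroup a.1 ⟨s, hsG⟩ (Subtype.ext hss) ?_ ?_ ?_⟩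
  · rw [mul_assoc, inv_mul_eq_iff_eq_mul]
    exact Subtype.ext (hinv a.1 a.2)
  · intro z hz
    have h1 := (hH _).mp (zpow_mem a.2 z)
    rw [hz, hs] at h1
    norm_num at h1
  · intro g
    rcases hdet g.1 g.2 with h | h
    · obtain ⟨z, hz⟩ := hgen g ((hH g).mpr h)
      exact ⟨z, .inl hz.symm⟩
    · obtain ⟨z, hz⟩ := hgen (⟨s, hsG⟩ * g) ((hH _).mpr (by
        rw [Subgroup.coe_mul, Units.val_mul, Matrix.det_mul, hs, h]
        norm_num))
      refine ⟨z, .inr ?_⟩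
      rw [hz, ← mul_assoc, show (⟨s, hsG⟩ : ↥G) * ⟨s, hsG⟩ = 1 from Subtype.ext hss, one_mul]

/-- Let `G ≤ GL₂(ℂ)` be finite, nonabelian, with image a dihedral group in
`PGL₂(ℂ)`, containing `-I₂`, and such that the defining (inclusion) representation `ρ`
satisfies `ρ ≅ det(ρ) ⊗ ρ` (equivalently, `ρ` is self-dual); the isomorphism is witnessed
by a conjugating matrix `P ∈ GL₂(ℂ)`.  Then `G` is isomorphic to a dihedral group or to a
binary dihedral (dicyclic/generalized quaternion) group. -/
theorem selfdual_central_dihedral_case (G : Subgroup (Matrix.GeneralLinearGroup (Fin 2) ℂ))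
    [Finite G]
    (hnonab : ¬ ∀ x y : ↥G, x * y = y * x)
    (n : ℕ) (hn3 : 3 ≤ n)
    (himage : Nonempty (↥(Subgroup.map projPGL2 G) ≃* DihedralGroup n))
    (hneg : (-1 : Matrix.GeneralLinearGroup (Fin 2) ℂ) ∈ G)
    (hselfdual : ∃ P : Matrix.GeneralLinearGroup (Fin 2) ℂ, ∀ g ∈ G,
      ((P * g * P⁻¹ : Matrix.GeneralLinearGroup (Fin 2) ℂ) : Matrix (Fin 2) (Fin 2) ℂ)
        = ((g : Matrix (Fin 2) (Fin 2) ℂ)).det • (g : Matrix (Fin 2) (Fin 2) ℂ)) :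
    (∃ k : ℕ, Nonempty (↥G ≃* DihedralGroup k)) ∨
    (∃ k : ℕ, Nonempty (↥G ≃* QuaternionGroup k)) := by
  obtain ⟨P, hP⟩ := hselfdual
  have hdet : ∀ g ∈ G, (g : Matrix (Fin 2) (Fin 2) ℂ).det = 1 ∨
      (g : Matrix (Fin 2) (Fin 2) ℂ).det = -1 := by
    intro g hg
    have h := congrArg Matrix.det (hP g hg)
    rw [Units.val_mul, Units.val_mul, Matrix.det_units_conj, Matrix.det_smul, Fintype.card_fin] at h
    have h0 : (g : Matrix (Fin 2) (Fin 2) ℂ).det ≠ 0 := Matrix.GeneralLinearGroup.det_ne_zero g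
    refine eq_or_eq_neg_of_sq_eq_sq _ 1 (mul_right_cancel₀ h0 ?_)
    rw [← h, one_pow, one_mul]
  by_cases hSL : ∀ g ∈ G, (g : Matrix (Fin 2) (Fin 2) ℂ).det = 1
  · exact .inr ⟨n, nonempty_mulEquiv_quaternionGroup_of_det_eq_one G (by omega) himage hneg hSL⟩
  · push Not at hSL
    obtain ⟨s, hsG, hs⟩ := hSL
    refine .inl (exists_mulEquiv_dihedralGroup_of_det_eq_neg_one G P (fun g hg h => ?_)
      (fun g hg h => ?_) hdet s hsG ((hdet s hsG).resolve_left hs))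
    · exact Units.ext (by rw [hP g hg, h, one_smul])
    · exact Units.ext (by rw [hP g hg, h, neg_one_smul, Units.val_neg])
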